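/- Simulation bound: for every n ≥ 1 and every density matrix ρ on ℂ^(2ⁿ), the stabilizer extent satisfies Γ(ρ) ≥ 1 + C(ρ)/Mₙ, where Mₙ = max_{σ ∈ Stabₙ} ‖W_σ‖₁ is the maximum Wigner ℓ¹ norm over pure n-qubit stabilizer states. -/

import Mathlib

open Matrix Kronecker Finset
open scoped ComplexOrder

noncomputable section

def PX : Matrix (Fin 2) (Fin 2) ℂ := !![0, 1; 1, 0]
def PY : Matrix (Fin 2) (Fin 2) ℂ := !![0, -Complex.I; Complex.I, 0]
def PZ : Matrix (Fin 2) (Fin 2) ℂ := !![1, 0; 0, -1]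

/-- The single-qubit phase-point operator `A_{(q,p)}`. -/
def A1 (a : ZMod 2 × ZMod 2) : Matrix (Fin 2) (Fin 2) ℂ :=
  (1 / 2 : ℂ) • ((1 : Matrix (Fin 2) (Fin 2) ℂ)
    + ((-1 : ℂ) ^ a.2.val) • PX
    + ((-1 : ℂ) ^ (a.1.val + a.2.val)) • PY
    + ((-1 : ℂ) ^ a.1.val) • PZ)

def pauli : Fin 4 → Matrix (Fin 2) (Fin 2) ℂ := ![1, PX, PY, PZ]

/-- The `n`-qubit phase-point operator `A_α`, a Kronecker product of single-qubit ones. -/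
def phasePoint : (n : ℕ) → (Fin n → ZMod 2 × ZMod 2) → Matrix (Fin (2 ^ n)) (Fin (2 ^ n)) ℂ
  | 0, _ => 1
  | n + 1, α =>
      Matrix.reindex (finProdFinEquiv.trans (finCongr (by ring)))
        (finProdFinEquiv.trans (finCongr (by ring)))
        (A1 (α 0) ⊗ₖ phasePoint n fun i => α i.succ)

/-- An `n`-fold Kronecker product of Pauli matrices. -/
def pauliTensor : (n : ℕ) → (Fin n → Fin 4) → Matrix (Fin (2 ^ n)) (Fin (2 ^ n)) ℂ
  | 0, _ => 1
  | n + 1, f =>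
      Matrix.reindex (finProdFinEquiv.trans (finCongr (by ring)))
        (finProdFinEquiv.trans (finCongr (by ring)))
        (pauli (f 0) ⊗ₖ pauliTensor n fun i => f i.succ)

/-- The `n`-qubit Pauli group: phases `i^k` times tensor products of Paulis. -/
def PauliGroup (n : ℕ) : Set (Matrix (Fin (2 ^ n)) (Fin (2 ^ n)) ℂ) :=
  { M | ∃ (k : Fin 4) (f : Fin n → Fin 4), M = Complex.I ^ (k : ℕ) • pauliTensor n f }

/-- `S` is an abelian subgroup of the Pauli group of size `2^n` with `-I ∉ S`. -/
def IsStabGroup (n : ℕ) (S : Finset (Matrix (Fin (2 ^ n)) (Fin (2 ^ n)) ℂ)) : Prop :=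
  (∀ g ∈ S, g ∈ PauliGroup n) ∧
  (1 : Matrix (Fin (2 ^ n)) (Fin (2 ^ n)) ℂ) ∈ S ∧
  (∀ g ∈ S, ∀ h ∈ S, g * h ∈ S ∧ g * h = h * g) ∧
  S.card = 2 ^ n ∧
  (-1 : Matrix (Fin (2 ^ n)) (Fin (2 ^ n)) ℂ) ∉ S

/-- The set of pure `n`-qubit stabilizer states. -/
def Stab (n : ℕ) : Set (Matrix (Fin (2 ^ n)) (Fin (2 ^ n)) ℂ) :=
  { σ | ∃ S : Finset (Matrix (Fin (2 ^ n)) (Fin (2 ^ n)) ℂ),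
      IsStabGroup n S ∧ σ = ((2 : ℂ) ^ n)⁻¹ • ∑ g ∈ S, g }

/-- A density matrix: positive semidefinite with unit trace. -/
def IsDensity {d : ℕ} (ρ : Matrix (Fin d) (Fin d) ℂ) : Prop :=
  ρ.PosSemidef ∧ ρ.trace = 1

/-- The discrete Wigner function `W_ρ(α) = 2^{-n} Tr(ρ A_α)` (real part). -/
def Wig (n : ℕ) (ρ : Matrix (Fin (2 ^ n)) (Fin (2 ^ n)) ℂ)
    (α : Fin n → ZMod 2 × ZMod 2) : ℝ :=
  (((2 : ℂ) ^ n)⁻¹ * (ρ * phasePoint n α).trace).re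

/-- The free Wigner polytope: convex hull of stabilizer Wigner functions. -/
def WFree (n : ℕ) : Set ((Fin n → ZMod 2 × ZMod 2) → ℝ) :=
  convexHull ℝ { w | ∃ σ ∈ Stab n, w = Wig n σ }

/-- The ℓ¹ norm on phase-space functions. -/
def l1 {n : ℕ} (v : (Fin n → ZMod 2 × ZMod 2) → ℝ) : ℝ := ∑ α, |v α|

/-- The Wigner distance `C(ρ)`: ℓ¹ distance from `W_ρ` to the free polytope. -/
def Cdist (n : ℕ) (ρ : Matrix (Fin (2 ^ n)) (Fin (2 ^ n)) ℂ) : ℝ :=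
  sInf { d | ∃ f ∈ WFree n, d = l1 (Wig n ρ - f) }

/-- The stabilizer extent `Γ(ρ)`. -/
def Gam (n : ℕ) (ρ : Matrix (Fin (2 ^ n)) (Fin (2 ^ n)) ℂ) : ℝ :=
  sInf { t | ∃ (k : ℕ) (a : Fin k → ℝ) (s : Fin k → Matrix (Fin (2 ^ n)) (Fin (2 ^ n)) ℂ),
      (∀ i, s i ∈ Stab n) ∧ ρ = ∑ i, a i • s i ∧ t = ∑ i, |a i| }

/-- Kronecker product with index bookkeeping `Fin (2^n) × Fin (2^m) ≃ Fin (2^(n+m))`. -/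
def kron {n m : ℕ} (M : Matrix (Fin (2 ^ n)) (Fin (2 ^ n)) ℂ)
    (N : Matrix (Fin (2 ^ m)) (Fin (2 ^ m)) ℂ) :
    Matrix (Fin (2 ^ (n + m))) (Fin (2 ^ (n + m))) ℂ :=
  Matrix.reindex (finProdFinEquiv.trans (finCongr (pow_add 2 n m).symm))
    (finProdFinEquiv.trans (finCongr (pow_add 2 n m).symm)) (M ⊗ₖ N)

/-- The Kronecker product of a single-qubit matrix with an `n`-qubit matrix, indexed as in
`pauliTensor`. -/
def qubitKron {n : ℕ} (s : Matrix (Fin 2) (Fin 2) ℂ) (M : Matrix (Fin (2 ^ n)) (Fin (2 ^ n)) ℂ) :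
    Matrix (Fin (2 ^ (n + 1))) (Fin (2 ^ (n + 1))) ℂ :=
  Matrix.reindex (finProdFinEquiv.trans (finCongr (by ring)))
    (finProdFinEquiv.trans (finCongr (by ring))) (s ⊗ₖ M)

section qubitKron

variable {n : ℕ}

theorem pauliTensor_cons (j : Fin 4) (f : Fin n → Fin 4) :
    pauliTensor (n + 1) (Fin.cons j f) = qubitKron (pauli j) (pauliTensor n f) := by
  simp [pauliTensor, qubitKron]

theorem pauliTensor_succ (f : Fin (n + 1) → Fin 4) :
    pauliTensor (n + 1) f = qubitKron (pauli (f 0)) (pauliTensor n fun i => f i.succ) := rfl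

theorem qubitKron_mul (s t : Matrix (Fin 2) (Fin 2) ℂ) (M N : Matrix (Fin (2 ^ n)) (Fin (2 ^ n)) ℂ) :
    qubitKron s M * qubitKron t N = qubitKron (s * t) (M * N) := by
  simp only [qubitKron, reindex_apply, submatrix_mul_equiv, mul_kronecker_mul]

theorem qubitKron_one_one :
    qubitKron 1 (1 : Matrix (Fin (2 ^ n)) (Fin (2 ^ n)) ℂ) = 1 := by
  simp only [qubitKron, reindex_apply, one_kronecker_one, submatrix_one_equiv]

theorem trace_qubitKron (s : Matrix (Fin 2) (Fin 2) ℂ) (M : Matrix (Fin (2 ^ n)) (Fin (2 ^ n)) ℂ) :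
    (qubitKron s M).trace = s.trace * M.trace := by
  rw [← trace_kronecker, qubitKron, Matrix.trace, Matrix.trace]
  exact Equiv.sum_comp (finProdFinEquiv.trans (finCongr (by ring))).symm
    fun i => (s ⊗ₖ M) i i

theorem qubitKron_eq_iff {s t : Matrix (Fin 2) (Fin 2) ℂ}
    {M N : Matrix (Fin (2 ^ n)) (Fin (2 ^ n)) ℂ} :
    qubitKron s M = qubitKron t N ↔ ∀ i j k l, s i j * M k l = t i j * N k l := by
  rw [qubitKron, qubitKron, (Matrix.reindex _ _).injective.eq_iff, ← Matrix.ext_iff]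
  exact ⟨fun h i j k l => h (i, k) (j, l), fun h p q => h p.1 q.1 p.2 q.2⟩

theorem qubitKron_add (s : Matrix (Fin 2) (Fin 2) ℂ) (M N : Matrix (Fin (2 ^ n)) (Fin (2 ^ n)) ℂ) :
    qubitKron s (M + N) = qubitKron s M + qubitKron s N := by
  simp only [qubitKron, kronecker_add]
  rfl

theorem add_qubitKron (s t : Matrix (Fin 2) (Fin 2) ℂ) (M : Matrix (Fin (2 ^ n)) (Fin (2 ^ n)) ℂ) :
    qubitKron (s + t) M = qubitKron s M + qubitKron t M := by
  simp only [qubitKron, add_kronecker]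
  rfl

theorem qubitKron_smul (c : ℂ) (s : Matrix (Fin 2) (Fin 2) ℂ)
    (M : Matrix (Fin (2 ^ n)) (Fin (2 ^ n)) ℂ) :
    qubitKron s (c • M) = c • qubitKron s M := by
  simp only [qubitKron, kronecker_smul]
  rfl

theorem smul_qubitKron (c : ℂ) (s : Matrix (Fin 2) (Fin 2) ℂ)
    (M : Matrix (Fin (2 ^ n)) (Fin (2 ^ n)) ℂ) :
    qubitKron (c • s) M = c • qubitKron s M := by
  simp only [qubitKron, smul_kronecker]
  rfl

/-- `M ↦ s ⊗ M` as a complex-linear map. -/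
def qubitKronHom (s : Matrix (Fin 2) (Fin 2) ℂ) :
    Matrix (Fin (2 ^ n)) (Fin (2 ^ n)) ℂ →ₗ[ℂ] Matrix (Fin (2 ^ (n + 1))) (Fin (2 ^ (n + 1))) ℂ where
  toFun := qubitKron s
  map_add' := qubitKron_add s
  map_smul' c M := qubitKron_smul c s M

theorem qubitKron_one_injective :
    Function.Injective (qubitKron 1 : Matrix (Fin (2 ^ n)) (Fin (2 ^ n)) ℂ → _) := by
  intro M N h
  ext k l
  simpa using qubitKron_eq_iff.1 h 0 0 k l

theorem qubitKron_injective {s : Matrix (Fin 2) (Fin 2) ℂ} (hs : s * s = 1) :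
    Function.Injective (qubitKron s : Matrix (Fin (2 ^ n)) (Fin (2 ^ n)) ℂ → _) := by
  intro M N h
  apply qubitKron_one_injective
  simpa [qubitKron_mul, hs] using
    congrArg (qubitKron s (1 : Matrix (Fin (2 ^ n)) (Fin (2 ^ n)) ℂ) * ·) h

theorem eq_zero_of_qubitKron_one_eq {s : Matrix (Fin 2) (Fin 2) ℂ} (hs : s.trace = 0)
    {M N : Matrix (Fin (2 ^ n)) (Fin (2 ^ n)) ℂ} (h : qubitKron 1 M = qubitKron s N) : M = 0 := by
  ext k l
  have h0 := qubitKron_eq_iff.1 h 0 0 k l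
  have h1 := qubitKron_eq_iff.1 h 1 1 k l
  rw [trace_fin_two] at hs
  simp only [one_apply_eq, one_mul] at h0 h1
  rw [Matrix.zero_apply]
  linear_combination (h0 + h1 + N k l * hs) / 2

end qubitKron

theorem pauli_mul_self (j : Fin 4) : pauli j * pauli j = 1 := by
  fin_cases j <;> simp [pauli, PX, PY, PZ, one_fin_two]

theorem trace_pauli {j : Fin 4} (hj : j ≠ 0) : (pauli j).trace = 0 := by
  fin_cases j <;> simp_all [pauli, PX, PY, PZ, trace_fin_two]

theorem pauliTensor_mul_self : ∀ (n : ℕ) (f : Fin n → Fin 4),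
    pauliTensor n f * pauliTensor n f = 1
  | 0, f => by simp [pauliTensor]
  | n + 1, f => by
    rw [pauliTensor_succ, qubitKron_mul, pauli_mul_self, pauliTensor_mul_self n, qubitKron_one_one]

theorem pauliTensor_zero : ∀ n : ℕ, pauliTensor n (fun _ => 0) = 1
  | 0 => rfl
  | n + 1 => by
    rw [pauliTensor_succ, pauliTensor_zero n]
    exact qubitKron_one_one

theorem trace_pauliTensor : ∀ (n : ℕ) (f : Fin n → Fin 4), (f ≠ fun _ => 0) →
    (pauliTensor n f).trace = 0
  | 0, f, hf => (hf (Subsingleton.elim _ _)).elim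
  | n + 1, f, hf => by
    rw [pauliTensor_succ, trace_qubitKron]
    by_cases h0 : f 0 = 0
    · rw [trace_pauliTensor n, mul_zero]
      intro h
      exact hf (funext fun i => Fin.cases h0 (congrFun h) i)
    · rw [trace_pauli h0, zero_mul]

theorem smul_mem_pauliGroup {n : ℕ} (m : ℕ) (f : Fin n → Fin 4) :
    Complex.I ^ m • pauliTensor n f ∈ PauliGroup n :=
  ⟨⟨m % 4, Nat.mod_lt _ (by norm_num)⟩, f, by rw [Complex.I_pow_eq_pow_mod]⟩

theorem ne_zero_of_mem_pauliGroup {n : ℕ} {g : Matrix (Fin (2 ^ n)) (Fin (2 ^ n)) ℂ}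
    (hg : g ∈ PauliGroup n) : g ≠ 0 := by
  obtain ⟨k, f, rfl⟩ := hg
  refine smul_ne_zero (pow_ne_zero _ Complex.I_ne_zero) fun h => ?_
  simpa [h] using pauliTensor_mul_self n f

theorem qubitKron_mem_pauliGroup {n : ℕ} (m : ℕ) (j : Fin 4)
    {g : Matrix (Fin (2 ^ n)) (Fin (2 ^ n)) ℂ} (hg : g ∈ PauliGroup n) :
    qubitKron (Complex.I ^ m • pauli j) g ∈ PauliGroup (n + 1) := by
  obtain ⟨k, f, rfl⟩ := hg
  rw [smul_qubitKron, qubitKron_smul, ← pauliTensor_cons, smul_smul, ← pow_add]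
  exact smul_mem_pauliGroup _ _

theorem pauliGroup_finite (n : ℕ) : (PauliGroup n).Finite := by
  refine (Set.finite_range fun p : Fin 4 × (Fin n → Fin 4) =>
    Complex.I ^ (p.1 : ℕ) • pauliTensor n p.2).subset ?_
  rintro _ ⟨k, f, rfl⟩
  exact ⟨(k, f), rfl⟩

theorem stab_finite (n : ℕ) : (Stab n).Finite := by
  refine ((pauliGroup_finite n).toFinset.powerset.finite_toSet.image
    fun S => ((2 : ℂ) ^ n)⁻¹ • ∑ g ∈ S, g).subset ?_
  rintro _ ⟨S, hS, rfl⟩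
  refine ⟨S, ?_, rfl⟩
  simpa [Set.subset_def] using hS.1

theorem bddAbove_l1_wig (n : ℕ) : BddAbove { v | ∃ σ ∈ Stab n, v = l1 (Wig n σ) } := by
  refine (((stab_finite n).image fun σ => l1 (Wig n σ)).subset ?_).bddAbove
  rintro _ ⟨σ, hσ, rfl⟩
  exact ⟨σ, hσ, rfl⟩

theorem IsStabGroup.trace_eq_zero {n : ℕ} {S : Finset (Matrix (Fin (2 ^ n)) (Fin (2 ^ n)) ℂ)}
    (hS : IsStabGroup n S) {g : Matrix (Fin (2 ^ n)) (Fin (2 ^ n)) ℂ} (hg : g ∈ S) (hg1 : g ≠ 1) :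
    g.trace = 0 := by
  obtain ⟨hP, -, hmul, -, hneg⟩ := hS
  obtain ⟨k, f, rfl⟩ := hP g hg
  rw [trace_smul]
  by_cases hf : f = fun _ => 0
  · subst hf
    have hsq := (hmul _ hg _ hg).1
    rw [pauliTensor_zero] at hg hg1 hsq
    fin_cases k <;> simp_all [pow_succ, smul_smul]
  · rw [trace_pauliTensor n f hf, smul_zero]

theorem trace_of_mem_stab {n : ℕ} {σ : Matrix (Fin (2 ^ n)) (Fin (2 ^ n)) ℂ} (hσ : σ ∈ Stab n) :
    σ.trace = 1 := by
  obtain ⟨S, hS, rfl⟩ := hσ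
  rw [trace_smul, trace_sum, Finset.sum_eq_single 1 (fun g hg hg1 => hS.trace_eq_zero hg hg1)
    fun h => (h hS.2.1).elim]
  simp

open Classical in
theorem disjoint_image_qubitKron {n : ℕ} {S : Finset (Matrix (Fin (2 ^ n)) (Fin (2 ^ n)) ℂ)}
    (hS : ∀ g ∈ S, g ∈ PauliGroup n) {s : Matrix (Fin 2) (Fin 2) ℂ} (hst : s.trace = 0) :
    Disjoint (S.image (qubitKron 1)) (S.image (qubitKron s)) := by
  rw [disjoint_left]
  intro g hg hg'
  obtain ⟨M, hM, rfl⟩ := mem_image.1 hg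
  obtain ⟨N, -, hN⟩ := mem_image.1 hg'
  exact ne_zero_of_mem_pauliGroup (hS M hM) (eq_zero_of_qubitKron_one_eq hst hN.symm)

open Classical in
theorem IsStabGroup.union_qubitKron {n : ℕ} {S : Finset (Matrix (Fin (2 ^ n)) (Fin (2 ^ n)) ℂ)}
    (hS : IsStabGroup n S) {s : Matrix (Fin 2) (Fin 2) ℂ} (m : ℕ) (j : Fin 4)
    (hs : s = Complex.I ^ m • pauli j) (hss : s * s = 1) (hst : s.trace = 0) :
    IsStabGroup (n + 1) (S.image (qubitKron 1) ∪ S.image (qubitKron s)) := by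
  obtain ⟨hP, hone, hmul, hcard, hneg⟩ := hS
  refine ⟨?_, ?_, ?_, ?_, ?_⟩
  · intro g hg
    simp only [mem_union, mem_image] at hg
    obtain ⟨h, hh, rfl⟩ | ⟨h, hh, rfl⟩ := hg
    · simpa [pauli] using qubitKron_mem_pauliGroup 0 0 (hP h hh)
    · exact hs ▸ qubitKron_mem_pauliGroup m j (hP h hh)
  · exact mem_union_left _ (mem_image.2 ⟨1, hone, qubitKron_one_one⟩)
  · intro g hg h hh
    simp only [mem_union, mem_image] at hg hh ⊢
    obtain ⟨g, hg, rfl⟩ | ⟨g, hg, rfl⟩ := hg <;> obtain ⟨h, hh, rfl⟩ | ⟨h, hh, rfl⟩ := hh <;>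
      simp only [qubitKron_mul, hss, mul_one, one_mul, ← (hmul g hg h hh).2, and_true]
    · exact Or.inl ⟨_, (hmul g hg h hh).1, rfl⟩
    · exact Or.inr ⟨_, (hmul g hg h hh).1, rfl⟩
    · exact Or.inr ⟨_, (hmul g hg h hh).1, rfl⟩
    · exact Or.inl ⟨_, (hmul g hg h hh).1, rfl⟩
  · rw [card_union_of_disjoint, card_image_of_injective _ qubitKron_one_injective,
      card_image_of_injective _ (qubitKron_injective hss), hcard, pow_succ, mul_two]
    exact disjoint_image_qubitKron hP hst
  · intro h
    have h1 : (-1 : Matrix (Fin (2 ^ (n + 1))) (Fin (2 ^ (n + 1))) ℂ) = qubitKron 1 (-1) := by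
      rw [← neg_one_smul ℂ (1 : Matrix (Fin (2 ^ n)) _ ℂ), qubitKron_smul, qubitKron_one_one,
        neg_one_smul]
    rw [h1, mem_union, mem_image, mem_image] at h
    obtain ⟨M, hM, hM'⟩ | ⟨M, -, hM⟩ := h
    · exact hneg (qubitKron_one_injective hM' ▸ hM)
    · simpa using eq_zero_of_qubitKron_one_eq hst hM.symm

theorem qubitKron_mem_stab {n : ℕ} {σ : Matrix (Fin (2 ^ n)) (Fin (2 ^ n)) ℂ} (hσ : σ ∈ Stab n)
    {s : Matrix (Fin 2) (Fin 2) ℂ} (m : ℕ) (j : Fin 4)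
    (hs : s = Complex.I ^ m • pauli j) (hss : s * s = 1) (hst : s.trace = 0) :
    qubitKron ((2 : ℂ)⁻¹ • (1 + s)) σ ∈ Stab (n + 1) := by
  classical
  obtain ⟨S, hS, rfl⟩ := hσ
  refine ⟨_, hS.union_qubitKron m j hs hss hst, ?_⟩
  have hsum : ∀ t : Matrix (Fin 2) (Fin 2) ℂ,
      ∑ g ∈ S, qubitKron t g = qubitKron t (∑ g ∈ S, g) := fun t =>
    (map_sum (qubitKronHom t) (fun g => g) S).symm
  rw [sum_union (disjoint_image_qubitKron hS.1 hst), sum_image qubitKron_one_injective.injOn,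
    sum_image (qubitKron_injective hss).injOn, hsum, hsum, ← add_qubitKron, smul_qubitKron,
    qubitKron_smul, smul_smul]
  congr 1
  rw [pow_succ, mul_inv, mul_comm]

theorem qubitKron_mem_span {n : ℕ} {M : Matrix (Fin (2 ^ n)) (Fin (2 ^ n)) ℂ}
    (hM : M ∈ Submodule.span ℝ (Stab n)) (m : ℕ) {j : Fin 4} (hj : j ≠ 0)
    (hm : (Complex.I ^ m) ^ 2 = 1) :
    qubitKron ((2 : ℂ)⁻¹ • (1 + Complex.I ^ m • pauli j)) M ∈ Submodule.span ℝ (Stab (n + 1)) := by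
  have hle : Submodule.span ℝ (Stab n) ≤ (Submodule.span ℝ (Stab (n + 1))).comap
      ((qubitKronHom ((2 : ℂ)⁻¹ • (1 + Complex.I ^ m • pauli j))).restrictScalars ℝ) := by
    refine Submodule.span_le.2 fun σ hσ => Submodule.subset_span ?_
    refine qubitKron_mem_stab hσ m j rfl ?_ ?_
    · rw [smul_mul_smul_comm, pauli_mul_self, ← sq, hm, one_smul]
    · rw [trace_smul, trace_pauli hj, smul_zero]
  exact hle hM

theorem qubitKron_pauli_mem_span {n : ℕ} {M : Matrix (Fin (2 ^ n)) (Fin (2 ^ n)) ℂ}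
    (hM : M ∈ Submodule.span ℝ (Stab n)) (j : Fin 4) :
    qubitKron (pauli j) M ∈ Submodule.span ℝ (Stab (n + 1)) := by
  by_cases hj : j = 0
  · have h := add_mem (qubitKron_mem_span hM 0 (j := 1) (by decide) (by simp))
      (qubitKron_mem_span hM 2 (j := 1) (by decide) (by simp))
    rw [← add_qubitKron] at h
    convert h using 2
    subst hj
    simp only [pauli, Complex.I_sq, pow_zero, Matrix.cons_val_zero]
    module
  · have h := sub_mem (qubitKron_mem_span hM 0 hj (by simp))
      (qubitKron_mem_span hM 2 hj (by simp))
    rw [sub_eq_add_neg, ← neg_one_smul ℂ (qubitKron _ M), ← smul_qubitKron, ← add_qubitKron] at h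
    convert h using 2
    simp only [Complex.I_sq, pow_zero]
    module

theorem exists_qubitKron_decomposition {n : ℕ}
    {H : Matrix (Fin (2 ^ (n + 1))) (Fin (2 ^ (n + 1))) ℂ} (hH : H.IsHermitian) :
    ∃ B : Fin 4 → Matrix (Fin (2 ^ n)) (Fin (2 ^ n)) ℂ,
      (∀ j, (B j).IsHermitian) ∧ H = ∑ j, qubitKron (pauli j) (B j) := by
  let e : Fin 2 × Fin (2 ^ n) ≃ Fin (2 ^ (n + 1)) :=
    finProdFinEquiv.trans (finCongr (by ring))
  let b (i j : Fin 2) : Matrix (Fin (2 ^ n)) (Fin (2 ^ n)) ℂ := of fun k l => H (e (i, k)) (e (j, l))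
  have hb : ∀ i j, (b i j)ᴴ = b j i := fun i j => by
    ext k l
    exact hH.apply _ _
  refine ⟨![(2 : ℂ)⁻¹ • (b 0 0 + b 1 1), (2 : ℂ)⁻¹ • (b 0 1 + b 1 0),
    (Complex.I / 2) • (b 0 1 - b 1 0), (2 : ℂ)⁻¹ • (b 0 0 - b 1 1)], ?_, ?_⟩
  · intro j
    clear_value b
    fin_cases j <;> simp [IsHermitian, conjTranspose_smul, hb]
    · rw [add_comm]
    · rw [neg_div, neg_smul, ← smul_neg, neg_sub]
  · apply (Matrix.reindex e e).symm.injective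
    ext ⟨i, k⟩ ⟨j, l⟩
    have hq : ∀ (t : Matrix (Fin 2) (Fin 2) ℂ) (N : Matrix (Fin (2 ^ n)) (Fin (2 ^ n)) ℂ),
        qubitKron t N (e (i, k)) (e (j, l)) = t i j * N k l := fun t N => by
      simp [qubitKron, e]
    have hH : H (e (i, k)) (e (j, l)) = b i j k l := rfl
    rw [reindex_symm, reindex_apply, submatrix_apply, reindex_apply, submatrix_apply,
      Equiv.symm_symm, Matrix.sum_apply, Fin.sum_univ_four]
    simp only [hq, hH]
    clear_value b e
    clear hq hH hb
    have hI := Complex.I_mul_I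
    fin_cases i <;> fin_cases j <;> simp [pauli, PX, PY, PZ]
    · ring
    · linear_combination (b 0 1 k l - b 1 0 k l) / 2 * hI
    · linear_combination (b 1 0 k l - b 0 1 k l) / 2 * hI
    · ring

theorem mem_span_stab_of_isHermitian : ∀ (n : ℕ) (H : Matrix (Fin (2 ^ n)) (Fin (2 ^ n)) ℂ),
    H.IsHermitian → H ∈ Submodule.span ℝ (Stab n)
  | 0, H, hH => by
    have h1 : (1 : Matrix (Fin (2 ^ 0)) (Fin (2 ^ 0)) ℂ) ∈ Stab 0 := by
      refine ⟨{1}, ⟨?_, ?_, ?_, ?_, ?_⟩, ?_⟩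
      · intro g hg
        exact ⟨0, fun _ => 0, by simpa [pauliTensor] using hg⟩
      · simp
      · simp
      · simp
      · rw [Finset.mem_singleton]
        intro h
        have := congrFun (congrFun h 0) 0
        norm_num at this
      · simp
    have hH' : H = (H 0 0).re • (1 : Matrix (Fin (2 ^ 0)) (Fin (2 ^ 0)) ℂ) := by
      ext i j
      obtain rfl : i = 0 := Subsingleton.elim (α := Fin 1) _ _
      obtain rfl : j = 0 := Subsingleton.elim (α := Fin 1) _ _
      simpa using (hH.coe_re_apply_self 0).symm
    rw [hH']
    exact Submodule.smul_mem _ _ (Submodule.subset_span h1)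
  | n + 1, H, hH => by
    obtain ⟨B, hB, rfl⟩ := exists_qubitKron_decomposition hH
    exact sum_mem fun j _ =>
      qubitKron_pauli_mem_span (mem_span_stab_of_isHermitian n (B j) (hB j)) j

theorem exists_sum_of_isHermitian {n : ℕ} (H : Matrix (Fin (2 ^ n)) (Fin (2 ^ n)) ℂ)
    (hH : H.IsHermitian) :
    ∃ (k : ℕ) (a : Fin k → ℝ) (s : Fin k → Matrix (Fin (2 ^ n)) (Fin (2 ^ n)) ℂ),
      (∀ i, s i ∈ Stab n) ∧ H = ∑ i, a i • s i := by
  obtain ⟨k, a, s, h⟩ := Submodule.mem_span_set'.1 (mem_span_stab_of_isHermitian n H hH)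
  exact ⟨k, a, fun i => s i, fun i => (s i).2, h.symm⟩

theorem l1_nonneg {n : ℕ} (v : (Fin n → ZMod 2 × ZMod 2) → ℝ) : 0 ≤ l1 v :=
  sum_nonneg fun _ _ => abs_nonneg _

theorem l1_sum_smul_le {n k : ℕ} (c : Fin k → ℝ) (w : Fin k → (Fin n → ZMod 2 × ZMod 2) → ℝ) :
    l1 (∑ i, c i • w i) ≤ ∑ i, |c i| * l1 (w i) := by
  simp only [l1, mul_sum]
  rw [sum_comm]
  refine sum_le_sum fun α _ => ?_
  rw [Finset.sum_apply]
  refine (abs_sum_le_sum_abs _ _).trans_eq ?_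
  simp [abs_mul]

theorem wig_sum_smul {n k : ℕ} (a : Fin k → ℝ)
    (s : Fin k → Matrix (Fin (2 ^ n)) (Fin (2 ^ n)) ℂ) :
    Wig n (∑ i, a i • s i) = ∑ i, a i • Wig n (s i) := by
  ext α
  simp only [Wig, Finset.sum_mul, trace_sum, smul_mul, trace_smul, Finset.mul_sum, Complex.re_sum,
    Finset.sum_apply, Pi.smul_apply, mul_smul_comm, Complex.smul_re]

theorem cdist_le {n : ℕ} (ρ : Matrix (Fin (2 ^ n)) (Fin (2 ^ n)) ℂ)
    {f : (Fin n → ZMod 2 × ZMod 2) → ℝ} (hf : f ∈ WFree n) : Cdist n ρ ≤ l1 (Wig n ρ - f) := by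
  refine csInf_le ⟨0, ?_⟩ ⟨f, hf, rfl⟩
  rintro _ ⟨g, -, rfl⟩
  exact l1_nonneg _

theorem cdist_sum_le {n k : ℕ} (a : Fin k → ℝ)
    (s : Fin k → Matrix (Fin (2 ^ n)) (Fin (2 ^ n)) ℂ) (hs : ∀ i, s i ∈ Stab n)
    (ha : ∑ i, a i = 1) (M : ℝ) (hM : ∀ i, l1 (Wig n (s i)) ≤ M) :
    Cdist n (∑ i, a i • s i) ≤ (∑ i, |a i| - 1) * M := by
  set P := ∑ i, max (a i) 0 with hP
  have hP1 : 1 ≤ P := ha ▸ sum_le_sum fun i _ => le_max_left _ _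
  have hP0 : 0 < P := by linarith
  have hsum : ∑ i, max (a i) 0 / P = 1 := by rw [← sum_div, ← hP, div_self hP0.ne']
  have hf : ∑ i, (max (a i) 0 / P) • Wig n (s i) ∈ WFree n :=
    (convex_convexHull ℝ _).sum_mem (fun i _ => by positivity) hsum
      fun i _ => subset_convexHull ℝ _ ⟨s i, hs i, rfl⟩
  have habs : ∀ i, |a i - max (a i) 0 / P| = |a i| - max (a i) 0 / P := fun i => by
    rcases le_total 0 (a i) with h | h
    · rw [max_eq_left h, abs_of_nonneg h, abs_of_nonneg (sub_nonneg.2 (div_le_self h hP1))]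
    · simp [max_eq_right h]
  calc Cdist n (∑ i, a i • s i)
      ≤ l1 (Wig n (∑ i, a i • s i) - ∑ i, (max (a i) 0 / P) • Wig n (s i)) := cdist_le _ hf
    _ = l1 (∑ i, (a i - max (a i) 0 / P) • Wig n (s i)) := by
      rw [wig_sum_smul, ← sum_sub_distrib]
      simp only [sub_smul]
    _ ≤ ∑ i, |a i - max (a i) 0 / P| * l1 (Wig n (s i)) := l1_sum_smul_le _ _
    _ ≤ ∑ i, |a i - max (a i) 0 / P| * M :=
      sum_le_sum fun i _ => mul_le_mul_of_nonneg_left (hM i) (abs_nonneg _)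
    _ = (∑ i, |a i| - 1) * M := by
      simp only [habs]
      rw [← sum_mul, sum_sub_distrib, hsum]

/-- the simulation bound `Γ(ρ) ≥ 1 + C(ρ)/Mₙ`, where `Mₙ` is the
maximum Wigner ℓ¹ norm over pure stabilizer states. -/
theorem gam_ge_one_add_Cdist_div_M (n : ℕ) (hn : 1 ≤ n)
    (ρ : Matrix (Fin (2 ^ n)) (Fin (2 ^ n)) ℂ) (hρ : IsDensity ρ) :
    1 + Cdist n ρ / sSup { v | ∃ σ ∈ Stab n, v = l1 (Wig n σ) } ≤ Gam n ρ := by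
  apply le_csInf
  · obtain ⟨k, a, s, hs, h⟩ := exists_sum_of_isHermitian ρ hρ.1.isHermitian
    exact ⟨_, k, a, s, hs, h, rfl⟩
  rintro t ⟨k, a, s, hs, h, rfl⟩
  have hM : ∀ i, l1 (Wig n (s i)) ≤ sSup { v | ∃ σ ∈ Stab n, v = l1 (Wig n σ) } := fun i =>
    le_csSup (bddAbove_l1_wig n) ⟨s i, hs i, rfl⟩
  have hM0 : 0 ≤ sSup { v | ∃ σ ∈ Stab n, v = l1 (Wig n σ) } :=
    Real.sSup_nonneg (by rintro _ ⟨σ, -, rfl⟩; exact l1_nonneg _)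
  generalize sSup { v | ∃ σ ∈ Stab n, v = l1 (Wig n σ) } = M at hM hM0
  have ha : ∑ i, a i = 1 := by
    have ht := hρ.2
    rw [h, trace_sum] at ht
    simp only [trace_smul, trace_of_mem_stab (hs _)] at ht
    exact_mod_cast (show ((∑ i, a i : ℝ) : ℂ) = 1 by simpa using ht)
  have ht1 : 1 ≤ ∑ i, |a i| := ha ▸ sum_le_sum fun i _ => le_abs_self (a i)
  have hC : Cdist n ρ ≤ (∑ i, |a i| - 1) * M := h ▸ cdist_sum_le a s hs ha M hM
  have := div_le_of_le_mul₀ hM0 (sub_nonneg.2 ht1) hC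
  linarith
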